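/- Let p ∈ (1,∞). Then (|x|^p − 1 − p(x−1)) / (x^{⟨p/2⟩} − 1)² tends to 2(p−1)/p as x → 1 along x ≠ 1. -/

import Mathlib

open Filter Topology

/-- Signed power: `a^{⟨κ⟩} := |a|^κ · sgn a`. -/
noncomputable def spow (a κ : ℝ) : ℝ := |a| ^ κ * Real.sign a

theorem tendsto_rpow_sub_one_div_sub_one (κ : ℝ) :
    Tendsto (fun x : ℝ => (x ^ κ - 1) / (x - 1)) (𝓝[≠] 1) (𝓝 κ) := by
  have h := Real.hasDerivAt_rpow_const (x := 1) (p := κ) (Or.inl one_ne_zero)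
  rw [hasDerivAt_iff_tendsto_slope] at h
  simpa [slope_fun_def_field] using h

theorem tendsto_rpow_sub_tangent_div_sq (p : ℝ) :
    Tendsto (fun x : ℝ => (x ^ p - 1 - p * (x - 1)) / (x - 1) ^ 2)
      (𝓝[≠] 1) (𝓝 (p * (p - 1) / 2)) := by
  have hpos : ∀ᶠ x : ℝ in 𝓝[≠] 1, 0 < x :=
    eventually_nhdsWithin_of_eventually_nhds (lt_mem_nhds one_pos)
  refine HasDerivAt.lhopital_zero_nhdsNE (f' := fun x => p * x ^ (p - 1) - p)
    (g' := fun x => 2 * (x - 1)) ?_ ?_ ?_ ?_ ?_ ?_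
  · filter_upwards [hpos] with x hx
    simpa using ((Real.hasDerivAt_rpow_const (p := p) (Or.inl hx.ne')).sub_const 1).fun_sub
      (((hasDerivAt_id x).sub_const 1).const_mul p)
  · refine Eventually.of_forall fun x => ?_
    simpa using ((hasDerivAt_id x).sub_const 1).fun_pow 2
  · filter_upwards [self_mem_nhdsWithin] with x hx
    exact mul_ne_zero two_ne_zero (sub_ne_zero.2 hx)
  · have h : ContinuousAt (fun x : ℝ => x ^ p - 1 - p * (x - 1)) 1 := by
      fun_prop (disch := norm_num)
    simpa using h.tendsto.mono_left nhdsWithin_le_nhds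
  · have h : ContinuousAt (fun x : ℝ => (x - 1) ^ 2) 1 := by fun_prop
    simpa using h.tendsto.mono_left nhdsWithin_le_nhds
  · have h := (tendsto_rpow_sub_one_div_sub_one (p - 1)).const_mul (p / 2)
    rw [div_mul_eq_mul_div] at h
    refine h.congr fun x => ?_
    rw [div_mul_div_comm, mul_sub, mul_one]

theorem spow_of_pos {a : ℝ} (ha : 0 < a) (κ : ℝ) : spow a κ = a ^ κ := by
  rw [spow, abs_of_pos ha, Real.sign_of_pos ha, mul_one]

theorem tendsto_bregman_ratio_nhds_one (p : ℝ) (hp : 1 < p) :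
    Tendsto (fun x : ℝ => (|x| ^ p - 1 - p * (x - 1)) / (spow x (p / 2) - 1) ^ 2)
      (𝓝[≠] 1) (𝓝 (2 * (p - 1) / p)) := by
  have hp0 : p ≠ 0 := by positivity
  have h := (tendsto_rpow_sub_tangent_div_sq p).div
    ((tendsto_rpow_sub_one_div_sub_one (p / 2)).pow 2) (by positivity)
  have hlim : p * (p - 1) / 2 / (p / 2) ^ 2 = 2 * (p - 1) / p := by
    field_simp
  rw [hlim] at h
  refine h.congr' ?_
  filter_upwards [self_mem_nhdsWithin,
    eventually_nhdsWithin_of_eventually_nhds (lt_mem_nhds one_pos)] with x hx hx0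
  have hx1 : (x - 1) ^ 2 ≠ 0 := pow_ne_zero 2 (sub_ne_zero.2 hx)
  rw [Pi.div_apply, spow_of_pos hx0, abs_of_pos hx0, div_pow, div_div_div_cancel_right₀ hx1]
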